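/- arXiv:1903.00311 — 2 statements merged into one kernel-verified Lean document; each statement's English description precedes it below -/
import Mathlib

section
/- Let ω ∈ (0,1) be irrational and ε > 0. There exists δ₀ > 0 such that for all δ ∈ (0, δ₀): Σ_{(q,p) ∈ ConstType} e^{−(|q|+|p|)δ}/|qω − p| ≤ ( 8/(1+ω)² + ε ) · δ^{−2}. -/
open Real
open scoped ENNReal Classical

noncomputable section

def cfX (ω : ℝ) : ℕ → ℝ
  | 0 => ω
  | n + 1 => Int.fract (cfX ω n)⁻¹

def cfA (ω : ℝ) : ℕ → ℕ
  | 0 => 0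
  | n + 1 => (⌊(cfX ω n)⁻¹⌋).toNat

def cfQ (ω : ℝ) : ℕ → ℕ
  | 0 => 1
  | 1 => cfA ω 1
  | n + 2 => cfA ω (n + 2) * cfQ ω (n + 1) + cfQ ω n

def cfP (ω : ℝ) : ℕ → ℕ
  | 0 => 0
  | 1 => 1
  | n + 2 => cfA ω (n + 2) * cfP ω (n + 1) + cfP ω n

/-- `a*_{k+1}`: `⌊√((a_{k+1}+2)/2)⌋`, decremented by one if `√((a_{k+1}+2)/2)` is an integer. -/
def aStar (ω : ℝ) (k : ℕ) : ℕ :=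
  if ∃ m : ℕ, cfA ω (k + 1) + 2 = 2 * m ^ 2 then
    (⌊Real.sqrt (((cfA ω (k + 1) : ℝ) + 2) / 2)⌋).toNat - 1
  else (⌊Real.sqrt (((cfA ω (k + 1) : ℝ) + 2) / 2)⌋).toNat

/-- The set `Brjuno⁺` of indices `(q,p) = (a q_k, a p_k)`, `1 ≤ a ≤ a*_{k+1}`. -/
def BrjunoPlus (ω : ℝ) : Set (ℤ × ℤ) :=
  {qp | ∃ (k : ℕ) (a : ℕ), 1 ≤ a ∧ a ≤ aStar ω k ∧
    qp.1 = (a : ℤ) * (cfQ ω k : ℤ) ∧ qp.2 = (a : ℤ) * (cfP ω k : ℤ)}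

/-- `Brjuno = Brjuno⁺ ∪ (−Brjuno⁺)`. -/
def BrjunoSet (ω : ℝ) : Set (ℤ × ℤ) := BrjunoPlus ω ∪ {qp | -qp ∈ BrjunoPlus ω}

/-- `ConstType`: indices in the critical strip which are not Brjuno indices. -/
def ConstTypeSet (ω : ℝ) : Set (ℤ × ℤ) :=
  {qp | qp ≠ (0, 0) ∧ |(qp.1 : ℝ) * ω - (qp.2 : ℝ)| < 1} \ BrjunoSet ω

end

section ContinuedFraction

variable {ω : ℝ}

theorem cfX_irrational_mem (hirr : Irrational ω) (hω0 : 0 < ω) (hω1 : ω < 1) (n : ℕ) :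
    Irrational (cfX ω n) ∧ 0 < cfX ω n ∧ cfX ω n < 1 := by
  induction n with
  | zero => exact ⟨hirr, hω0, hω1⟩
  | succ n ih =>
    have h : Irrational (Int.fract (cfX ω n)⁻¹) := by
      rw [Int.fract]
      exact ih.1.inv.sub_intCast _
    refine ⟨h, ?_, Int.fract_lt_one _⟩
    exact lt_of_le_of_ne (Int.fract_nonneg _) (Ne.symm h.ne_zero)

theorem cfA_cast (hirr : Irrational ω) (hω0 : 0 < ω) (hω1 : ω < 1) (n : ℕ) :
    ((cfA ω (n + 1) : ℕ) : ℤ) = ⌊(cfX ω n)⁻¹⌋ := by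
  have h := (cfX_irrational_mem hirr hω0 hω1 n).2.1
  exact Int.toNat_of_nonneg (Int.floor_nonneg.2 (inv_nonneg.2 h.le))

theorem one_le_cfA (hirr : Irrational ω) (hω0 : 0 < ω) (hω1 : ω < 1) (n : ℕ) :
    1 ≤ cfA ω (n + 1) := by
  obtain ⟨-, h0, h1⟩ := cfX_irrational_mem hirr hω0 hω1 n
  have h : (1 : ℤ) ≤ ⌊(cfX ω n)⁻¹⌋ := by
    rw [Int.le_floor]
    exact_mod_cast (one_le_inv₀ h0).2 h1.le
  rw [← cfA_cast hirr hω0 hω1] at h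
  exact_mod_cast h

theorem cfX_inv (hirr : Irrational ω) (hω0 : 0 < ω) (hω1 : ω < 1) (n : ℕ) :
    (cfX ω n)⁻¹ = cfA ω (n + 1) + cfX ω (n + 1) := by
  have h : (cfA ω (n + 1) : ℝ) = (⌊(cfX ω n)⁻¹⌋ : ℝ) := by
    rw [← cfA_cast hirr hω0 hω1, Int.cast_natCast]
  rw [h]
  exact (Int.floor_add_fract _).symm

theorem cfQ_pos_and_le_succ (hirr : Irrational ω) (hω0 : 0 < ω) (hω1 : ω < 1) (n : ℕ) :
    1 ≤ cfQ ω n ∧ cfQ ω n ≤ cfQ ω (n + 1) := by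
  induction n with
  | zero => exact ⟨le_rfl, one_le_cfA hirr hω0 hω1 0⟩
  | succ n ih =>
    refine ⟨ih.1.trans ih.2, ?_⟩
    have h := one_le_cfA hirr hω0 hω1 (n + 1)
    simp only [cfQ]
    nlinarith [Nat.mul_le_mul_right (cfQ ω (n + 1)) h]

theorem cfP_mul_cfQ_sub (n : ℕ) :
    (cfP ω (n + 1) : ℤ) * cfQ ω n - cfP ω n * cfQ ω (n + 1) = (-1) ^ n := by
  induction n with
  | zero => simp [cfP, cfQ]
  | succ n ih =>
    simp only [cfP, cfQ] at ih ⊢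
    push_cast
    rw [pow_succ, ← ih]
    ring

theorem isCoprime_cfP_cfQ (n : ℕ) : IsCoprime (cfP ω n : ℤ) (cfQ ω n : ℤ) := by
  refine ⟨-(-1) ^ n * cfQ ω (n + 1), (-1) ^ n * cfP ω (n + 1), ?_⟩
  have h := cfP_mul_cfQ_sub (ω := ω) n
  have h2 : ((-1 : ℤ) ^ n) * (-1) ^ n = 1 := by
    rw [← mul_pow]; simp
  linear_combination (-1) ^ n * h + h2

theorem cfQ_mul_sub_cfP_succ (hirr : Irrational ω) (hω0 : 0 < ω) (hω1 : ω < 1) (n : ℕ) :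
    cfQ ω (n + 1) * ω - cfP ω (n + 1) = -cfX ω (n + 1) * (cfQ ω n * ω - cfP ω n) := by
  induction n with
  | zero =>
    have h := cfX_inv hirr hω0 hω1 0
    have h' : cfX ω (0 + 1) = ω⁻¹ - cfA ω (0 + 1) := by
      rw [eq_sub_iff_add_eq', ← h]; rfl
    rw [h']
    simp only [cfQ, cfP]
    field_simp
    push_cast
    ring
  | succ n ih =>
    have h := cfX_inv hirr hω0 hω1 (n + 1)
    have hx := (cfX_irrational_mem hirr hω0 hω1 (n + 1)).2.1
    have h' : cfX ω (n + 1 + 1) = (cfX ω (n + 1))⁻¹ - cfA ω (n + 1 + 1) := by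
      rw [h]; ring
    rw [h', ih]
    have e : cfQ ω (n + 1 + 1) * ω - cfP ω (n + 1 + 1) =
        cfA ω (n + 1 + 1) * (cfQ ω (n + 1) * ω - cfP ω (n + 1)) + (cfQ ω n * ω - cfP ω n) := by
      simp only [cfQ, cfP]
      push_cast
      ring
    rw [e, ih]
    field_simp
    ring

theorem abs_cfQ_mul_sub_cfP_succ (hirr : Irrational ω) (hω0 : 0 < ω) (hω1 : ω < 1) (n : ℕ) :
    |cfQ ω (n + 1) * ω - cfP ω (n + 1)| = cfX ω (n + 1) * |cfQ ω n * ω - cfP ω n| := by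
  rw [cfQ_mul_sub_cfP_succ hirr hω0 hω1, abs_mul, abs_neg,
    abs_of_pos (cfX_irrational_mem hirr hω0 hω1 (n + 1)).2.1]

theorem abs_mul_cfQ_add_eq_one (hirr : Irrational ω) (hω0 : 0 < ω) (hω1 : ω < 1) (n : ℕ) :
    |cfQ ω n * ω - cfP ω n| * cfQ ω (n + 1) + |cfQ ω (n + 1) * ω - cfP ω (n + 1)| * cfQ ω n
      = 1 := by
  induction n with
  | zero =>
    have h := cfX_inv hirr hω0 hω1 0
    have h' : cfX ω (0 + 1) = ω⁻¹ - cfA ω (0 + 1) := by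
      rw [eq_sub_iff_add_eq', ← h]; rfl
    rw [abs_cfQ_mul_sub_cfP_succ hirr hω0 hω1, h']
    simp only [cfQ, cfP]
    push_cast
    rw [one_mul, sub_zero, abs_of_pos hω0]
    field_simp
    ring
  | succ n ih =>
    rw [← ih]
    have h := cfX_inv hirr hω0 hω1 (n + 1)
    have hx := (cfX_irrational_mem hirr hω0 hω1 (n + 1)).2.1
    have h' : cfX ω (n + 1 + 1) = (cfX ω (n + 1))⁻¹ - cfA ω (n + 1 + 1) := by
      rw [h]; ring
    rw [abs_cfQ_mul_sub_cfP_succ hirr hω0 hω1 (n + 1), abs_cfQ_mul_sub_cfP_succ hirr hω0 hω1 n, h']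
    have e : (cfQ ω (n + 1 + 1) : ℝ) = cfA ω (n + 1 + 1) * cfQ ω (n + 1) + cfQ ω n := by
      simp only [cfQ]
      push_cast
      ring
    rw [e]
    field_simp
    ring

theorem one_le_cfQ_mul_abs (hirr : Irrational ω) (hω0 : 0 < ω) (hω1 : ω < 1) (n : ℕ) :
    1 ≤ (cfA ω (n + 1) + 2) * (cfQ ω n * |cfQ ω n * ω - cfP ω n|) := by
  have h := abs_mul_cfQ_add_eq_one hirr hω0 hω1 n
  rw [abs_cfQ_mul_sub_cfP_succ hirr hω0 hω1] at h
  have hx := (cfX_irrational_mem hirr hω0 hω1 (n + 1)).2.2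
  have hE := abs_nonneg (cfQ ω n * ω - cfP ω n)
  generalize |cfQ ω n * ω - cfP ω n| = E at *
  have hq : (cfQ ω (n + 1) : ℝ) ≤ (cfA ω (n + 1) + 1) * cfQ ω n := by
    cases n with
    | zero => simp [cfQ]
    | succ n =>
      have h2 : (cfQ ω n : ℝ) ≤ cfQ ω (n + 1) :=
        mod_cast (cfQ_pos_and_le_succ hirr hω0 hω1 n).2
      rw [cfQ]
      push_cast
      linarith
  have hQ : (0 : ℝ) ≤ cfQ ω n := Nat.cast_nonneg _
  nlinarith [mul_le_mul_of_nonneg_left hq hE, mul_le_mul_of_nonneg_right hx.le (mul_nonneg hE hQ)]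

theorem convergent_nonneg {ξ : ℝ} (hξ : 0 ≤ ξ) (m : ℕ) : 0 ≤ ξ.convergent m := by
  induction m generalizing ξ with
  | zero => simpa using Int.floor_nonneg.2 hξ
  | succ m ih =>
    rw [Real.convergent_succ]
    exact add_nonneg (mod_cast Int.floor_nonneg.2 hξ)
      (inv_nonneg.2 (ih (inv_nonneg.2 (Int.fract_nonneg _))))

theorem convergent_pos {ξ : ℝ} (hξ : 1 ≤ ξ) (m : ℕ) : 0 < ξ.convergent m := by
  have h : (0 : ℚ) < ⌊ξ⌋ := mod_cast Int.floor_pos.2 hξ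
  cases m with
  | zero => simpa using h
  | succ m =>
    rw [Real.convergent_succ]
    exact add_pos_of_pos_of_nonneg h
      (inv_nonneg.2 (convergent_nonneg (inv_nonneg.2 (Int.fract_nonneg _)) m))

theorem convergent_add_two (hirr : Irrational ω) (hω0 : 0 < ω) (hω1 : ω < 1) (n m : ℕ) :
    ω.convergent (n + 2 + m) =
      ((cfX ω (n + 1))⁻¹.convergent m * cfP ω (n + 1) + cfP ω n) /
        ((cfX ω (n + 1))⁻¹.convergent m * cfQ ω (n + 1) + cfQ ω n) := by
  have hpos : ∀ n m, 0 < (cfX ω n)⁻¹.convergent m := fun n m => by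
    obtain ⟨-, h0, h1⟩ := cfX_irrational_mem hirr hω0 hω1 n
    exact convergent_pos ((one_le_inv₀ h0).2 h1.le) m
  have hstep : ∀ n m, (cfX ω n)⁻¹.convergent (m + 1) =
      cfA ω (n + 1) + ((cfX ω (n + 1))⁻¹.convergent m)⁻¹ := fun n m => by
    rw [Real.convergent_succ, ← cfA_cast hirr hω0 hω1, Int.cast_natCast]
    rfl
  induction n generalizing m with
  | zero =>
    have h1 : ω.convergent (0 + 2 + m) = ((cfX ω 0)⁻¹.convergent (m + 1))⁻¹ := by
      rw [show 0 + 2 + m = (m + 1) + 1 by ring, Real.convergent_succ,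
        Int.floor_eq_zero_iff.2 ⟨hω0.le, hω1⟩, Int.fract_eq_self.2 ⟨hω0.le, hω1⟩]
      simp [cfX]
    rw [h1, hstep]
    have hc := hpos (0 + 1) m
    simp only [cfP, cfQ]
    generalize (cfX ω (0 + 1))⁻¹.convergent m = c at *
    push_cast
    rw [show (cfA ω (0 + 1) : ℚ) + c⁻¹ = (c * cfA ω 1 + 1) / c by field_simp, inv_div]
    ring
  | succ n ih =>
    rw [show n + 1 + 2 + m = n + 2 + (m + 1) by ring, ih, hstep]
    have hc := hpos (n + 1 + 1) m
    have hq : (1 : ℚ) ≤ cfQ ω n := mod_cast (cfQ_pos_and_le_succ hirr hω0 hω1 n).1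
    simp only [cfP, cfQ]
    generalize (cfX ω (n + 1 + 1))⁻¹.convergent m = c at *
    push_cast
    have h1 : (0 : ℚ) < (cfA ω (n + 1 + 1) + c⁻¹) * cfQ ω (n + 1) + cfQ ω n := by positivity
    have h2 : (0 : ℚ) < c * (cfA ω (n + 2) * cfQ ω (n + 1) + cfQ ω n) + cfQ ω (n + 1) := by
      positivity
    rw [div_eq_div_iff h1.ne' h2.ne']
    field_simp
    ring

theorem convergent_eq_cfP_div_cfQ (hirr : Irrational ω) (hω0 : 0 < ω) (hω1 : ω < 1) (n : ℕ) :
    ω.convergent n = cfP ω n / cfQ ω n := by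
  match n with
  | 0 => simp [cfP, Int.floor_eq_zero_iff.2 ⟨hω0.le, hω1⟩]
  | 1 =>
    have h := cfA_cast hirr hω0 hω1 0
    rw [Real.convergent_succ, Real.convergent_zero, Int.floor_eq_zero_iff.2 ⟨hω0.le, hω1⟩,
      Int.fract_eq_self.2 ⟨hω0.le, hω1⟩, show ω⁻¹ = (cfX ω 0)⁻¹ from rfl, ← h]
    simp [cfP, cfQ]
  | n + 2 =>
    rw [convergent_add_two hirr hω0 hω1 n 0, Real.convergent_zero, ← cfA_cast hirr hω0 hω1]
    simp only [cfP, cfQ]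
    push_cast
    rfl

theorem two_mul_sq_of_aStar_lt {k a : ℕ} (h : aStar ω k < a) :
    cfA ω (k + 1) + 2 ≤ 2 * a ^ 2 := by
  unfold aStar at h
  split_ifs at h with hm
  · obtain ⟨m, hm⟩ := hm
    have e : ((cfA ω (k + 1) : ℝ) + 2) / 2 = (m : ℝ) ^ 2 := by
      have : (cfA ω (k + 1) : ℝ) + 2 = 2 * (m : ℝ) ^ 2 := mod_cast hm
      rw [this]; ring
    rw [e, Real.sqrt_sq (Nat.cast_nonneg m), Int.floor_natCast, Int.toNat_natCast] at h
    have : m ≤ a := by omega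
    rw [hm]
    gcongr
  · have h1 : ⌊Real.sqrt (((cfA ω (k + 1) : ℝ) + 2) / 2)⌋ < (a : ℤ) := by omega
    rw [Int.floor_lt, Int.cast_natCast] at h1
    have h2 := (Real.sqrt_le_left (Nat.cast_nonneg a)).1 h1.le
    have h3 : (cfA ω (k + 1) : ℝ) + 2 ≤ 2 * (a : ℝ) ^ 2 := by linarith
    exact_mod_cast h3

/-- Legendre's theorem, in the form of a lower bound off the Brjuno indices. -/
theorem half_le_mul_abs_of_notMem_brjunoPlus (hirr : Irrational ω) (hω0 : 0 < ω) (hω1 : ω < 1)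
    {q p : ℤ} (hq : 0 < q) (hqp : (q, p) ∉ BrjunoPlus ω) :
    1 / 2 ≤ (q : ℝ) * |q * ω - p| := by
  by_contra! hlt
  have hqR : (0 : ℝ) < q := mod_cast hq
  have hden : (((p / q : ℚ).den : ℕ) : ℝ) ≤ q := by
    have h := Int.le_of_dvd hq (Rat.den_dvd p q)
    rw [Rat.divInt_eq_div] at h
    exact_mod_cast h
  have hden0 : (0 : ℝ) < ((p / q : ℚ).den : ℕ) := mod_cast (p / q : ℚ).den_pos
  have hleg : |ω - ((p / q : ℚ) : ℝ)| < 1 / (2 * ((p / q : ℚ).den : ℝ) ^ 2) := by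
    have e : ω - ((p / q : ℚ) : ℝ) = (q * ω - p) / q := by
      push_cast
      field_simp
    rw [e, abs_div, abs_of_pos hqR]
    calc |(q : ℝ) * ω - p| / q < 1 / (2 * (q : ℝ) ^ 2) := by
          rw [div_lt_div_iff₀ hqR (by positivity)]
          nlinarith
      _ ≤ _ := by gcongr
  obtain ⟨n, hn⟩ := Real.exists_rat_eq_convergent hleg
  rw [convergent_eq_cfP_div_cfQ hirr hω0 hω1] at hn
  have hQ := (cfQ_pos_and_le_succ hirr hω0 hω1 n).1
  have hcross : p * cfQ ω n = cfP ω n * q := by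
    have h1 : (q : ℚ) ≠ 0 := mod_cast hq.ne'
    have h2 : (cfQ ω n : ℚ) ≠ 0 := mod_cast (by omega : cfQ ω n ≠ 0)
    rw [div_eq_div_iff h1 h2] at hn
    exact_mod_cast hn
  obtain ⟨a, ha⟩ : (cfQ ω n : ℤ) ∣ q :=
    (isCoprime_cfP_cfQ (ω := ω) n).symm.dvd_of_dvd_mul_left ⟨p, by rw [← hcross]; ring⟩
  have hQ' : (0 : ℤ) < cfQ ω n := by exact_mod_cast hQ
  have ha0 : 0 < a := by
    rw [ha] at hq
    exact pos_of_mul_pos_right hq hQ'.le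
  have hp : p = a * cfP ω n := by
    apply mul_right_cancel₀ hQ'.ne'
    rw [hcross, ha]; ring
  lift a to ℕ using ha0.le
  have hbig : aStar ω n < a := by
    by_contra! hle
    exact hqp ⟨n, a, by omega, hle, by rw [ha]; ring, hp⟩
  have h2 : (cfA ω (n + 1) : ℝ) + 2 ≤ 2 * (a : ℝ) ^ 2 := mod_cast two_mul_sq_of_aStar_lt hbig
  have h1 := one_le_cfQ_mul_abs hirr hω0 hω1 n
  have e : (q : ℝ) * |q * ω - p| = (a : ℝ) ^ 2 * (cfQ ω n * |cfQ ω n * ω - cfP ω n|) := by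
    rw [ha, hp]
    push_cast
    rw [show (cfQ ω n : ℝ) * a * ω - a * cfP ω n = a * (cfQ ω n * ω - cfP ω n) by ring, abs_mul,
      Nat.abs_cast]
    ring
  rw [e] at hlt
  have h0 : 0 ≤ cfQ ω n * |cfQ ω n * ω - cfP ω n| := by positivity
  nlinarith [mul_le_mul_of_nonneg_right h2 h0]

theorem half_le_abs_mul_abs_of_mem_constTypeSet (hirr : Irrational ω) (hω0 : 0 < ω)
    (hω1 : ω < 1) {q p : ℤ} (h : (q, p) ∈ ConstTypeSet ω) :
    q ≠ 0 ∧ 1 / 2 ≤ |(q : ℝ)| * |q * ω - p| := by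
  obtain ⟨⟨h0, hlt⟩, hB⟩ := h
  simp only [BrjunoSet, Set.mem_union, not_or, Set.mem_ofPred_eq] at hB
  have hq : q ≠ 0 := by
    rintro rfl
    have hp : |p| < 1 := by
      have : |(p : ℝ)| < 1 := by simpa using hlt
      exact_mod_cast this
    exact h0 (by rw [Int.abs_lt_one_iff.1 hp])
  refine ⟨hq, ?_⟩
  rcases lt_or_gt_of_ne hq with hneg | hpos
  · have h := half_le_mul_abs_of_notMem_brjunoPlus hirr hω0 hω1 (q := -q) (p := -p)
      (by omega) hB.2
    have hR : (q : ℝ) < 0 := mod_cast hneg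
    rw [abs_of_neg hR, ← abs_neg ((q : ℝ) * ω - p)]
    convert h using 2
    · push_cast; rfl
    · push_cast; ring_nf
  · have hR : (0 : ℝ) < q := mod_cast hpos
    rw [abs_of_pos hR]
    exact half_le_mul_abs_of_notMem_brjunoPlus hirr hω0 hω1 hpos hB.1

end ContinuedFraction

theorem exp_neg_div_one_sub_sq_le {s : ℝ} (hs : 0 < s) :
    exp (-s) / (1 - exp (-s)) ^ 2 ≤ (s ^ 2)⁻¹ := by
  have hr : exp (-s) < 1 := Real.exp_lt_one_iff.2 (by linarith)
  have h1 : s / 2 ≤ sinh (s / 2) := Real.self_le_sinh_iff.2 (by linarith)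
  rw [Real.sinh_eq] at h1
  have h2 : s * exp (-(s / 2)) ≤ 1 - exp (-s) := by
    have e1 : exp (s / 2) * exp (-(s / 2)) = 1 := by rw [← exp_add]; simp
    have e2 : exp (-(s / 2)) * exp (-(s / 2)) = exp (-s) := by rw [← exp_add]; ring_nf
    nlinarith [mul_le_mul_of_nonneg_right h1 (exp_pos (-(s / 2))).le]
  have h3 : s ^ 2 * exp (-s) ≤ (1 - exp (-s)) ^ 2 := by
    have e2 : exp (-(s / 2)) ^ 2 = exp (-s) := by rw [← exp_nat_mul]; ring_nf
    rw [← e2, ← mul_pow, e2]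
    exact pow_le_pow_left₀ (by positivity) h2 2
  have h4 : 0 < (1 - exp (-s)) ^ 2 := by
    have : 0 < 1 - exp (-s) := by linarith
    positivity
  rw [div_le_iff₀ h4, inv_mul_eq_div, le_div_iff₀ (by positivity)]
  linarith

theorem tsum_ofReal_mul_exp_le {c s : ℝ} (hc : 0 ≤ c) (hs : 0 < s) :
    ∑' n : ℕ, ENNReal.ofReal (c * (n * exp (-s) ^ n)) ≤ ENNReal.ofReal (c * (s ^ 2)⁻¹) := by
  have hr : ‖exp (-s)‖ < 1 := by
    rw [Real.norm_of_nonneg (exp_pos _).le]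
    exact Real.exp_lt_one_iff.2 (by linarith)
  have h := (hasSum_coe_mul_geometric_of_norm_lt_one hr).mul_left c
  rw [← ENNReal.ofReal_tsum_of_nonneg (fun n => by positivity) h.summable, h.tsum_eq]
  exact ENNReal.ofReal_le_ofReal (mul_le_mul_of_nonneg_left (exp_neg_div_one_sub_sq_le hs) hc)

/-- In the strip `|q ω - p| < 1`, an index is determined by `|q|`, the sign of `q` and
whether `p = ⌊q ω⌋`. -/
theorem eq_of_mem_strip {ω : ℝ} {q p q' p' : ℤ} (h : |(q : ℝ) * ω - p| < 1)
    (h' : |(q' : ℝ) * ω - p'| < 1) (hs : 0 < q ↔ 0 < q') (hn : q.natAbs = q'.natAbs)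
    (hf : p = ⌊(q : ℝ) * ω⌋ ↔ p' = ⌊(q' : ℝ) * ω⌋) : (q, p) = (q', p') := by
  have hq : q = q' := by omega
  subst hq
  have key : ∀ r : ℤ, |(q : ℝ) * ω - r| < 1 → r = ⌊(q : ℝ) * ω⌋ ∨ r = ⌊(q : ℝ) * ω⌋ + 1 := by
    intro r hr
    rw [abs_lt] at hr
    have h1 : ⌊(q : ℝ) * ω⌋ < r + 1 := by
      rw [Int.floor_lt]; push_cast; linarith
    have h2 : r - 1 ≤ ⌊(q : ℝ) * ω⌋ := by
      rw [Int.le_floor]; push_cast; linarith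
    omega
  have h1 := key p h
  have h2 := key p' h'
  have : p = p' := by omega
  rw [this]

theorem exp_div_abs_le {ω δ : ℝ} (hω0 : 0 < ω) (hδ : 0 < δ) {q p : ℤ} (hq : q ≠ 0)
    (hlt : |(q : ℝ) * ω - p| < 1) (hhalf : 1 / 2 ≤ |(q : ℝ)| * |q * ω - p|) :
    exp (-((|q| + |p| : ℤ) : ℝ) * δ) / |q * ω - p| ≤
      2 * exp δ * (q.natAbs * exp (-((1 + ω) * δ)) ^ q.natAbs) := by
  have hN : ((q.natAbs : ℕ) : ℝ) = |(q : ℝ)| := by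
    rw [Nat.cast_natAbs, Int.cast_abs]
  have hqpos : 0 < |(q : ℝ)| := abs_pos.2 (mod_cast hq)
  have hE : 0 < |(q : ℝ) * ω - p| := by
    by_contra! h0
    nlinarith
  have hp : |(q : ℝ)| * ω - 1 ≤ |(p : ℝ)| := by
    have h := abs_sub_abs_le_abs_sub ((q : ℝ) * ω) p
    rw [abs_mul, abs_of_pos hω0] at h
    linarith
  rw [div_le_iff₀ hE, ← exp_nat_mul, hN]
  push_cast
  have h1 : exp (-(|(q : ℝ)| + |(p : ℝ)|) * δ) ≤
      exp δ * exp (|(q : ℝ)| * -((1 + ω) * δ)) := by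
    rw [← exp_add]
    apply exp_le_exp.2
    nlinarith
  refine h1.trans ?_
  have h2 : 0 < exp δ * exp (|(q : ℝ)| * -((1 + ω) * δ)) := by positivity
  nlinarith [mul_le_mul_of_nonneg_left hhalf h2.le]

theorem tsum_constTypeSet_le {ω : ℝ} (hirr : Irrational ω) (hω0 : 0 < ω) (hω1 : ω < 1)
    {δ : ℝ} (hδ : 0 < δ) :
    (∑' x : (ConstTypeSet ω),
        ENNReal.ofReal
          (Real.exp (-((|(x : ℤ × ℤ).1| + |(x : ℤ × ℤ).2| : ℤ) : ℝ) * δ) /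
            |((x : ℤ × ℤ).1 : ℝ) * ω - ((x : ℤ × ℤ).2 : ℝ)|)) ≤
      ENNReal.ofReal (8 / (1 + ω) ^ 2 * exp δ * δ⁻¹ ^ 2) := by
  have hs : 0 < (1 + ω) * δ := by positivity
  let φ : ConstTypeSet ω → (Bool × Bool) × ℕ := fun x =>
    ((decide (0 < x.1.1), decide (x.1.2 = ⌊(x.1.1 : ℝ) * ω⌋)), x.1.1.natAbs)
  let g : (Bool × Bool) × ℕ → ℝ≥0∞ := fun y =>
    ENNReal.ofReal (2 * exp δ * (y.2 * exp (-((1 + ω) * δ)) ^ y.2))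
  have hφ : Function.Injective φ := by
    rintro ⟨⟨q, p⟩, hx⟩ ⟨⟨q', p'⟩, hx'⟩ hxx
    simp only [φ, Prod.mk.injEq, decide_eq_decide] at hxx
    exact Subtype.ext (eq_of_mem_strip hx.1.2 hx'.1.2 hxx.1.1 hxx.2 hxx.1.2)
  calc _ ≤ ∑' x : ConstTypeSet ω, g (φ x) := by
        refine ENNReal.tsum_le_tsum fun x => ENNReal.ofReal_le_ofReal ?_
        obtain ⟨hq, hhalf⟩ := half_le_abs_mul_abs_of_mem_constTypeSet hirr hω0 hω1 x.2
        exact exp_div_abs_le hω0 hδ hq x.2.1.2 hhalf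
    _ ≤ ∑' y, g y := ENNReal.tsum_comp_le_tsum_of_injective hφ g
    _ = 4 * ∑' n : ℕ, ENNReal.ofReal (2 * exp δ * (n * exp (-((1 + ω) * δ)) ^ n)) := by
        rw [ENNReal.tsum_prod', tsum_fintype]
        simp only [g, Finset.sum_const, nsmul_eq_mul]
        simp
    _ ≤ 4 * ENNReal.ofReal (2 * exp δ * (((1 + ω) * δ) ^ 2)⁻¹) :=
        mul_le_mul_right (tsum_ofReal_mul_exp_le (by positivity) hs) _
    _ = _ := by
        rw [show (4 : ℝ≥0∞) = ENNReal.ofReal 4 by simp, ← ENNReal.ofReal_mul (by norm_num)]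
        congr 1
        field_simp
        ring

/-- for irrational `ω ∈ (0,1)` and `ε > 0` there is `δ₀ > 0` such that for all
`δ ∈ (0,δ₀)` the sum of `e^{-(|q|+|p|)δ}/|qω-p|` over `ConstType` is at most
`(8/(1+ω)² + ε) δ⁻²`. -/
theorem constType_sum_bound (ω : ℝ) (hirr : Irrational ω) (hω0 : 0 < ω) (hω1 : ω < 1)
    (ε : ℝ) (hε : 0 < ε) :
    ∃ δ₀ : ℝ, 0 < δ₀ ∧ ∀ δ : ℝ, 0 < δ → δ < δ₀ →
      (∑' x : (ConstTypeSet ω),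
          ENNReal.ofReal
            (Real.exp (-((|(x : ℤ × ℤ).1| + |(x : ℤ × ℤ).2| : ℤ) : ℝ) * δ) /
              |((x : ℤ × ℤ).1 : ℝ) * ω - ((x : ℤ × ℤ).2 : ℝ)|)) ≤
        ENNReal.ofReal ((8 / (1 + ω) ^ 2 + ε) * δ⁻¹ ^ 2) := by
  have hC : 0 < 8 / (1 + ω) ^ 2 := by positivity
  have hcont : Filter.Tendsto (fun δ : ℝ => 8 / (1 + ω) ^ 2 * exp δ) (nhds 0)
      (nhds (8 / (1 + ω) ^ 2)) := by
    have h : Continuous fun δ : ℝ => 8 / (1 + ω) ^ 2 * exp δ := by fun_prop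
    simpa using h.tendsto 0
  obtain ⟨δ₀, hδ₀, h⟩ := Metric.eventually_nhds_iff.1
    (hcont.eventually (gt_mem_nhds (show 8 / (1 + ω) ^ 2 < 8 / (1 + ω) ^ 2 + ε by linarith)))
  refine ⟨δ₀, hδ₀, fun δ hδ hlt => ?_⟩
  have hδ' := h (y := δ) (by rwa [Real.dist_eq, sub_zero, abs_of_pos hδ])
  refine (tsum_constTypeSet_le hirr hω0 hω1 hδ).trans (ENNReal.ofReal_le_ofReal ?_)
  gcongr
end

section
/- Let ω ∈ (0,1) be irrational, τ ≥ 1, and Δ ∈ (0, min(τ^{−1}, τ e^{−1})]. Then Σ_{n=1}^∞ e^{−q_n Δ} q_n^τ ≤ ((τ e^{−1})^τ / log φ) · Δ^{−τ} · ( log(Δ^{−1}) + log(3τφ) + Γ_Eul(τ)/(2 (τ e^{−1})^τ) ). -/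
open Real
open scoped ENNReal

noncomputable section

/-- The golden ratio `φ = (1+√5)/2`. -/
def goldenφ : ℝ := (1 + Real.sqrt 5) / 2

end

section

open Set MeasureTheory

theorem goldenφ_eq : goldenφ = Real.goldenRatio := rfl

theorem cfX_mem {ω : ℝ} (hirr : Irrational ω) (hω0 : 0 < ω) (hω1 : ω < 1) (n : ℕ) :
    Irrational (cfX ω n) ∧ 0 < cfX ω n ∧ cfX ω n < 1 := by
  induction n with
  | zero => exact ⟨hirr, hω0, hω1⟩
  | succ n ih =>
    have h : Irrational (cfX ω (n + 1)) := by
      rw [cfX, Int.fract]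
      exact (irrational_inv_iff.2 ih.1).sub_intCast ⌊(cfX ω n)⁻¹⌋
    exact ⟨h, lt_of_le_of_ne (Int.fract_nonneg _) h.ne_zero.symm, Int.fract_lt_one _⟩

theorem one_le_cfA_succ {ω : ℝ} (hirr : Irrational ω) (hω0 : 0 < ω) (hω1 : ω < 1) (n : ℕ) :
    1 ≤ cfA ω (n + 1) := by
  obtain ⟨-, h0, h1⟩ := cfX_mem hirr hω0 hω1 n
  have h : (1 : ℤ) ≤ ⌊(cfX ω n)⁻¹⌋ := Int.le_floor.2 (by simpa using (one_lt_inv₀ h0).2 h1 |>.le)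
  simp only [cfA]
  omega

theorem cfQ_add_le {ω : ℝ} (hirr : Irrational ω) (hω0 : 0 < ω) (hω1 : ω < 1) (n : ℕ) :
    cfQ ω (n + 1) + cfQ ω n ≤ cfQ ω (n + 2) := by
  have h := one_le_cfA_succ hirr hω0 hω1 (n + 1)
  rw [cfQ]
  exact Nat.add_le_add_right (Nat.le_mul_of_pos_left _ h) _

/-- A sequence satisfying the Fibonacci inequality grows at least like powers of `φ`. -/
theorem goldenφ_pow_mul_le {b : ℕ → ℝ} {T : ℝ} (hT : 0 ≤ T) (h0 : T ≤ b 0) (h1 : T ≤ b 1)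
    (hb : ∀ n, b (n + 1) + b n ≤ b (n + 2)) (n : ℕ) : goldenφ ^ n * T ≤ b (n + 1) := by
  induction n using Nat.twoStepInduction with
  | zero => simpa using h1
  | one =>
    have h2 : goldenφ < 2 := Real.goldenRatio_lt_two
    have := hb 0
    norm_num at this ⊢
    nlinarith
  | more n ih0 ih1 =>
    have hsq : goldenφ ^ 2 = goldenφ + 1 := Real.goldenRatio_sq
    calc goldenφ ^ (n + 2) * T = goldenφ ^ (n + 1) * T + goldenφ ^ n * T := by
          rw [pow_add, hsq]; ring
      _ ≤ b (n + 3) := (add_le_add ih1 ih0).trans (hb (n + 1))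

theorem exp_neg_mul_rpow_le {τ Δ x y : ℝ} (hτ : 0 ≤ τ) (hx : 0 < x) (hy : 0 < y)
    (h : τ * (y / x - 1) ≤ Δ * (y - x)) :
    Real.exp (-y * Δ) * y ^ τ ≤ Real.exp (-x * Δ) * x ^ τ := by
  rw [Real.rpow_def_of_pos hx, Real.rpow_def_of_pos hy, ← Real.exp_add, ← Real.exp_add,
    Real.exp_le_exp]
  have h1 := Real.log_le_sub_one_of_pos (div_pos hy hx)
  rw [Real.log_div hy.ne' hx.ne'] at h1
  nlinarith [mul_le_mul_of_nonneg_left h1 hτ]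

theorem exp_neg_mul_rpow_le_of_le {τ Δ x y : ℝ} (hτ : 0 ≤ τ) (hx : 0 < x) (hxy : x ≤ y)
    (h : τ ≤ x * Δ) :
    Real.exp (-y * Δ) * y ^ τ ≤ Real.exp (-x * Δ) * x ^ τ := by
  refine exp_neg_mul_rpow_le hτ hx (hx.trans_le hxy) ?_
  have h1 : 0 ≤ y / x - 1 := sub_nonneg.2 ((one_le_div hx).2 hxy)
  calc τ * (y / x - 1) ≤ x * Δ * (y / x - 1) := mul_le_mul_of_nonneg_right h h1
    _ = Δ * (y - x) := by field_simp

theorem exp_neg_mul_rpow_le_max {τ Δ y : ℝ} (hτ : 0 < τ) (hΔ : 0 < Δ) (hy : 0 < y) :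
    Real.exp (-y * Δ) * y ^ τ ≤ (τ * Real.exp (-1)) ^ τ * Δ ^ (-τ) := by
  refine (exp_neg_mul_rpow_le hτ.le (div_pos hτ hΔ) hy (le_of_eq (by field_simp))).trans_eq ?_
  rw [Real.mul_rpow hτ.le (Real.exp_pos _).le, ← Real.exp_mul, Real.div_rpow hτ.le hΔ.le,
    Real.rpow_neg hΔ.le, neg_mul, div_mul_cancel₀ _ hΔ.ne', neg_one_mul]
  ring

theorem lintegral_inv_Ioc {a b : ℝ} (ha : 0 < a) (hab : a ≤ b) :
    ∫⁻ x in Ioc a b, ENNReal.ofReal x⁻¹ = ENNReal.ofReal (Real.log (b / a)) := by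
  have hint : IntervalIntegrable (fun x : ℝ => x⁻¹) volume a b :=
    intervalIntegral.intervalIntegrable_inv
      (fun x hx => (ha.trans_le (by simpa [hab] using hx.1)).ne') continuousOn_id
  rw [← integral_inv_of_pos ha (ha.trans_le hab), intervalIntegral.integral_of_le hab,
    ofReal_integral_eq_lintegral_ofReal hint.1]
  filter_upwards [ae_restrict_mem measurableSet_Ioc] with x hx
  exact inv_nonneg.2 (ha.trans hx.1).le

theorem lintegral_gamma {τ Δ : ℝ} (hτ : 0 < τ) (hΔ : 0 < Δ) :
    ∫⁻ x in Ioi (0 : ℝ), ENNReal.ofReal (x ^ (τ - 1) * Real.exp (-(Δ * x))) =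
      ENNReal.ofReal (Δ ^ (-τ) * Real.Gamma τ) := by
  have h := Real.integral_rpow_mul_exp_neg_mul_Ioi hτ hΔ
  have hne : (1 / Δ) ^ τ * Real.Gamma τ ≠ 0 :=
    (mul_pos (Real.rpow_pos_of_pos (by positivity) _) (Real.Gamma_pos_of_pos hτ)).ne'
  rw [Real.rpow_neg hΔ.le, ← Real.inv_rpow hΔ.le, ← one_div, ← h,
    ofReal_integral_eq_lintegral_ofReal]
  · by_contra hni
    exact hne (h ▸ integral_undef hni)
  · filter_upwards [ae_restrict_mem measurableSet_Ioi] with x hx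
    have : (0 : ℝ) < x := hx
    simp only [Pi.zero_apply]
    positivity

/-- The reflection `x ↦ T² / x` decreases the Gamma density when `T = τ / Δ` is its mean. -/
theorem gamma_density_reflect_le {τ Δ x : ℝ} (hτ : 0 < τ) (hΔ : 0 < Δ) (hx : 0 < x)
    (hxT : x ≤ τ / Δ) :
    (τ / Δ) ^ 2 / x ^ 2 *
        (((τ / Δ) ^ 2 / x) ^ (τ - 1) * Real.exp (-(Δ * ((τ / Δ) ^ 2 / x)))) ≤
      x ^ (τ - 1) * Real.exp (-(Δ * x)) := by
  obtain ⟨T, rfl⟩ : ∃ T, τ = T * Δ := ⟨τ / Δ, (div_mul_cancel₀ _ hΔ.ne').symm⟩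
  have hT : 0 < T := pos_of_mul_pos_left hτ hΔ.le
  rw [mul_div_cancel_right₀ _ hΔ.ne'] at hxT ⊢
  have hy : 0 < T / x := div_pos hT hx
  have hlog : Real.log T - Real.log x ≤ (T / x - x / T) / 2 := by
    have := Real.self_le_sinh_iff.2 (Real.log_nonneg ((one_le_div hx).2 hxT))
    rwa [Real.sinh_log hy, inv_div, Real.log_div hT.ne' hx.ne'] at this
  rw [Real.rpow_def_of_pos hx, Real.rpow_def_of_pos (by positivity : 0 < T ^ 2 / x),
    ← Real.exp_add, ← Real.exp_add, ← Real.exp_log (by positivity : 0 < T ^ 2 / x ^ 2),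
    ← Real.exp_add, Real.exp_le_exp, Real.log_div (by positivity) (by positivity),
    Real.log_div (by positivity) hx.ne', Real.log_pow, Real.log_pow]
  have h := mul_le_mul_of_nonneg_left hlog hτ.le
  have e1 : T * Δ * ((T / x - x / T) / 2) = (Δ * (T ^ 2 / x) - Δ * x) / 2 := by
    field_simp
  rw [e1] at h
  push_cast
  nlinarith [h]

/-- The median of the Gamma distribution is at most its mean. -/
theorem lintegral_gamma_tail {τ Δ : ℝ} (hτ : 0 < τ) (hΔ : 0 < Δ) :
    2 * ∫⁻ x in Ioi (τ / Δ), ENNReal.ofReal (x ^ (τ - 1) * Real.exp (-(Δ * x))) ≤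
      ENNReal.ofReal (Δ ^ (-τ) * Real.Gamma τ) := by
  set T := τ / Δ with hTdef
  have hT : 0 < T := div_pos hτ hΔ
  have himage : (fun x => T ^ 2 / x) '' Ioo 0 T = Ioi T := by
    ext y
    simp only [mem_image, mem_Ioo, mem_Ioi]
    constructor
    · rintro ⟨x, ⟨hx0, hxT⟩, rfl⟩
      rw [lt_div_iff₀ hx0]
      nlinarith
    · intro hy
      have hy0 : 0 < y := hT.trans hy
      refine ⟨T ^ 2 / y, ⟨by positivity, ?_⟩, by field_simp⟩
      rw [div_lt_iff₀ hy0]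
      nlinarith
  have hderiv : ∀ x ∈ Ioo 0 T,
      HasDerivWithinAt (fun x => T ^ 2 / x) (-(T ^ 2 / x ^ 2)) (Ioo 0 T) x := by
    intro x hx
    have h := ((hasDerivAt_inv hx.1.ne').const_mul (T ^ 2)).hasDerivWithinAt (s := Ioo 0 T)
    simpa only [div_eq_mul_inv, mul_neg] using h
  have hinj : InjOn (fun x => T ^ 2 / x) (Ioo 0 T) := by
    intro x hx y hy hxy
    have hx0 := hx.1.ne'
    have hy0 := hy.1.ne'
    have hT0 := hT.ne'
    field_simp at hxy
    exact hxy.symm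
  have hreflect : ∫⁻ x in Ioi T, ENNReal.ofReal (x ^ (τ - 1) * Real.exp (-(Δ * x))) ≤
      ∫⁻ x in Ioo 0 T, ENNReal.ofReal (x ^ (τ - 1) * Real.exp (-(Δ * x))) := by
    rw [← himage, lintegral_image_eq_lintegral_abs_deriv_mul measurableSet_Ioo hderiv hinj]
    refine setLIntegral_mono' measurableSet_Ioo fun x hx => ?_
    rw [← ENNReal.ofReal_mul (abs_nonneg _), abs_neg, abs_of_nonneg (by positivity)]
    exact ENNReal.ofReal_le_ofReal (gamma_density_reflect_le hτ hΔ hx.1 hx.2.le)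
  rw [← lintegral_gamma hτ hΔ, two_mul]
  refine (add_le_add_left hreflect _).trans ?_
  rw [← lintegral_union measurableSet_Ioi
    (disjoint_left.2 fun x hx hx' => lt_asymm hx.2 hx')]
  exact lintegral_mono_set (union_subset (fun x hx => hx.1) fun x hx => hT.trans hx)

/-- Summing the Gamma weight over a sequence growing by factors of `φ` beyond the maximum. -/
theorem tsum_tail_le {τ Δ : ℝ} (hτ : 0 < τ) (hΔ : 0 < Δ) {b : ℕ → ℝ}
    (hb : ∀ n, goldenφ ^ (n + 1) * (τ / Δ) ≤ b n) :
    ∑' n, ENNReal.ofReal (Real.exp (-b n * Δ) * b n ^ τ) ≤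
      ENNReal.ofReal (Δ ^ (-τ) * Real.Gamma τ / (2 * Real.log goldenφ)) := by
  set T := τ / Δ with hTdef
  have hT : 0 < T := div_pos hτ hΔ
  have hφ : 1 < goldenφ := Real.one_lt_goldenRatio
  have hφ0 : 0 < goldenφ := one_pos.trans hφ
  have hL : 0 < Real.log goldenφ := Real.log_pos hφ
  set h : ℝ → ENNReal := fun x => ENNReal.ofReal (x ^ (τ - 1) * Real.exp (-(Δ * x)))
  set c : ℕ → ℝ := fun n => goldenφ ^ n * T with hc
  have hTc : ∀ n, T ≤ c n := fun n => le_mul_of_one_le_left hT.le (one_le_pow₀ hφ.le)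
  have hcm : Monotone c := fun m n hmn =>
    mul_le_mul_of_nonneg_right (pow_le_pow_right₀ hφ.le hmn) hT.le
  have hterm : ∀ n, ENNReal.ofReal (Real.exp (-b n * Δ) * b n ^ τ) *
      ENNReal.ofReal (Real.log goldenφ) ≤ ∫⁻ x in Ioc (c n) (c (n + 1)), h x := by
    intro n
    have hratio : c (n + 1) / c n = goldenφ := by
      simp only [hc]
      rw [pow_succ]
      field_simp
    rw [← hratio, ← lintegral_inv_Ioc (hT.trans_le (hTc n)) (hcm n.le_succ),
      ← lintegral_const_mul' _ _ ENNReal.ofReal_ne_top]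
    refine setLIntegral_mono' measurableSet_Ioc fun x hx => ?_
    have hTx : T ≤ x := (hTc n).trans hx.1.le
    have hx0 : 0 < x := hT.trans_le hTx
    have hb0 : 0 < b n := hx0.trans_le (hx.2.trans (hb n))
    rw [← ENNReal.ofReal_mul (by positivity)]
    refine ENNReal.ofReal_le_ofReal ?_
    calc Real.exp (-b n * Δ) * b n ^ τ * x⁻¹ ≤ Real.exp (-x * Δ) * x ^ τ * x⁻¹ :=
          mul_le_mul_of_nonneg_right (exp_neg_mul_rpow_le_of_le hτ.le hx0 (hx.2.trans (hb n))
            ((div_le_iff₀ hΔ).1 hTx)) (inv_nonneg.2 hx0.le)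
      _ = x ^ (τ - 1) * Real.exp (-(Δ * x)) := by
          rw [Real.rpow_sub_one hx0.ne', neg_mul, mul_comm x Δ]
          ring
  have hsum : (∑' n, ENNReal.ofReal (Real.exp (-b n * Δ) * b n ^ τ)) *
      ENNReal.ofReal (Real.log goldenφ) ≤ ∫⁻ x in Ioi T, h x := by
    rw [← ENNReal.tsum_mul_right]
    refine (ENNReal.tsum_le_tsum hterm).trans ?_
    have hdisj : Pairwise (Function.onFun Disjoint fun n => Ioc (c n) (c (n + 1))) :=
      hcm.pairwise_disjoint_on_Ioc_succ
    rw [← lintegral_iUnion (fun n => measurableSet_Ioc) hdisj]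
    exact lintegral_mono_set (iUnion_subset fun n x hx => (hTc n).trans_lt hx.1)
  rw [ENNReal.ofReal_div_of_pos (by positivity), ENNReal.le_div_iff_mul_le (by simp [hL]) (by simp),
    ENNReal.ofReal_mul zero_le_two, ENNReal.ofReal_ofNat]
  refine le_trans ?_ (lintegral_gamma_tail hτ hΔ)
  rw [mul_left_comm]
  gcongr

end

/-- for irrational `ω ∈ (0,1)`, `τ ≥ 1` and `Δ ∈ (0, min(τ⁻¹, τe⁻¹)]`:
`Σ_{n=1}^∞ e^{-q_n Δ} q_n^τ ≤ ((τe⁻¹)^τ/log φ) Δ^{-τ} (log Δ⁻¹ + log(3τφ) + Γ(τ)/(2(τe⁻¹)^τ))`. -/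
theorem dph1_bound (ω : ℝ) (hirr : Irrational ω) (hω0 : 0 < ω) (hω1 : ω < 1)
    (τ : ℝ) (hτ : 1 ≤ τ)
    (Δ : ℝ) (hΔ0 : 0 < Δ) (hΔ : Δ ≤ min τ⁻¹ (τ * Real.exp (-1))) :
    (∑' n : ℕ, ENNReal.ofReal
        (Real.exp (-(cfQ ω (n + 1) : ℝ) * Δ) * (cfQ ω (n + 1) : ℝ) ^ τ)) ≤
      ENNReal.ofReal
        ((τ * Real.exp (-1)) ^ τ / Real.log goldenφ * Δ ^ (-τ) *
          (Real.log Δ⁻¹ + Real.log (3 * τ * goldenφ) +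
            Real.Gamma τ / (2 * (τ * Real.exp (-1)) ^ τ))) := by
  have hτ0 : 0 < τ := one_pos.trans_le hτ
  have hφ : 1 < goldenφ := Real.one_lt_goldenRatio
  have hφ0 : 0 < goldenφ := one_pos.trans hφ
  have hL : 0 < Real.log goldenφ := Real.log_pos hφ
  set T := τ / Δ with hTdef
  have hT0 : 0 < T := div_pos hτ0 hΔ0
  have hT1 : 1 ≤ T := by
    rw [hTdef, one_le_div hΔ0]
    exact (hΔ.trans (min_le_left _ _)).trans ((inv_le_one_of_one_le₀ hτ).trans hτ)
  set q : ℕ → ℝ := fun n => (cfQ ω n : ℝ) with hq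
  have hq0 : q 0 = 1 := by simp [hq, cfQ]
  have hq1 : 1 ≤ q 1 := by
    simpa [hq, cfQ] using one_le_cfA_succ hirr hω0 hω1 0
  have hrec : ∀ n, q (n + 1) + q n ≤ q (n + 2) := fun n => by
    simp only [hq]
    exact_mod_cast cfQ_add_le hirr hω0 hω1 n
  have hpow : ∀ n, goldenφ ^ n ≤ q (n + 1) := fun n => by
    simpa using goldenφ_pow_mul_le zero_le_one hq0.ge hq1 hrec n
  have hqpos : ∀ n, 0 < q (n + 1) := fun n => (pow_pos hφ0 n).trans_le (hpow n)
  have hex : ∃ n, T < q (n + 1) :=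
    (pow_unbounded_of_one_lt T hφ).imp fun n hn => hn.trans_le (hpow n)
  classical
  obtain ⟨N, hN, hNmin⟩ : ∃ N, T < q (N + 1) ∧ ∀ m < N, q (m + 1) ≤ T :=
    ⟨Nat.find hex, Nat.find_spec hex, fun m hm => not_lt.1 (Nat.find_min hex hm)⟩
  have hNlog : N * Real.log goldenφ ≤ Real.log goldenφ + Real.log T := by
    cases N with
    | zero =>
      have := Real.log_nonneg hT1
      simpa using add_nonneg hL.le this
    | succ m =>
      have := Real.log_le_log (pow_pos hφ0 m) ((hpow m).trans (hNmin m m.lt_succ_self))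
      rw [Real.log_pow] at this
      push_cast
      linarith
  have hcount : (N + 2) * Real.log goldenφ ≤ Real.log Δ⁻¹ + Real.log (3 * τ * goldenφ) := by
    have h3 : 2 * Real.log goldenφ ≤ Real.log 3 := by
      have hsq : goldenφ ^ 2 = goldenφ + 1 := Real.goldenRatio_sq
      have h2 : goldenφ < 2 := Real.goldenRatio_lt_two
      have := Real.log_le_log (pow_pos hφ0 2) (by linarith : goldenφ ^ 2 ≤ 3)
      rw [Real.log_pow] at this
      exact_mod_cast this
    rw [hTdef, Real.log_div hτ0.ne' hΔ0.ne'] at hNlog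
    rw [Real.log_inv, Real.log_mul (by positivity) hφ0.ne', Real.log_mul (by norm_num) hτ0.ne']
    linarith
  have hbtail : ∀ n, goldenφ ^ (n + 1) * T ≤ q (n + (N + 2) + 1) := fun n => by
    have h1 : T ≤ q (N + 2) := by
      have := hrec N
      have : 0 ≤ q N := Nat.cast_nonneg _
      linarith
    have := goldenφ_pow_mul_le (b := fun k => q (k + (N + 1))) hT0.le
      (by simpa using hN.le) (by simpa [add_comm, add_left_comm] using h1)
      (fun k => by
        have := hrec (k + (N + 1))
        rwa [show k + (N + 1) + 1 = k + 1 + (N + 1) by ring,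
          show k + (N + 1) + 2 = k + 2 + (N + 1) by ring] at this) (n + 1)
    simpa only [show n + 1 + 1 + (N + 1) = n + (N + 2) + 1 by ring] using this
  have hhead : ∑ n ∈ Finset.range (N + 2),
      ENNReal.ofReal (Real.exp (-q (n + 1) * Δ) * q (n + 1) ^ τ) ≤
        ENNReal.ofReal ((N + 2) * ((τ * Real.exp (-1)) ^ τ * Δ ^ (-τ))) := by
    refine (Finset.sum_le_card_nsmul _ _ _ fun n _ =>
      ENNReal.ofReal_le_ofReal (exp_neg_mul_rpow_le_max hτ0 hΔ0 (hqpos n))).trans_eq ?_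
    rw [Finset.card_range, ← ENNReal.ofReal_nsmul, nsmul_eq_mul]
    push_cast
    rfl
  have hΓ := Real.Gamma_pos_of_pos hτ0
  rw [← ENNReal.summable.sum_add_tsum_nat_add' (k := N + 2)]
  refine (add_le_add hhead (tsum_tail_le hτ0 hΔ0 hbtail)).trans ?_
  rw [← ENNReal.ofReal_add (by positivity) (by positivity)]
  refine ENNReal.ofReal_le_ofReal ?_
  have hK : 0 < (τ * Real.exp (-1)) ^ τ := by positivity
  have hD : 0 < Δ ^ (-τ) := by positivity
  generalize (τ * Real.exp (-1)) ^ τ = K at hK ⊢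
  generalize Δ ^ (-τ) = D at hD ⊢
  calc (N + 2) * (K * D) + D * Real.Gamma τ / (2 * Real.log goldenφ)
      = K / Real.log goldenφ * D *
        ((N + 2) * Real.log goldenφ + Real.Gamma τ / (2 * K)) := by
        field_simp
    _ ≤ _ := by gcongr
end
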